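/- Suppose f is nondecreasing on (−∞,0] and nonincreasing on [0,∞), and ρ_t + η_t ≥ 0 for all t ≥ 0. Then for every time grid and every trade vector ξ ∈ ℝ^{N+1}, C^V(ξ, t) ≥ 0, C^V(ξ, t) → +∞ as |ξ| → ∞, and for every x ∈ ℝ there is a unique minimizer ξ* of C^V(·, t) over {ξ : Σ_{i=0}^N ξ_i = −x}. It is given as follows: the equation Σ_{i=1}^N λ(t_{i−1})(1−a_i)·h_{V,i}⁻¹(ν) + λ(t_N)·F(ν) = −x has a unique solution ν ∈ ℝ, and ξ*_0 = λ(t_0)·h_{V,1}⁻¹(ν), ξ*_i = λ(t_i)·(h_{V,i+1}⁻¹(ν) − ã_i·h_{V,i}⁻¹(ν)) for 1 ≤ i ≤ N−1, ξ*_N = λ(t_N)·F(ν) − λ(t_{N−1})·a_N·h_{V,N}⁻¹(ν). The first and last trades satisfy −x·ξ*_0 ≥ 0 and −x·ξ*_N ≥ 0; if moreover (1/ã_i)·(1−ã_i)/(1−a_i) ≥ (1−ã_{i+1})/(1−a_{i+1}) for 1 ≤ i ≤ N−1, then −x·ξ*_i ≥ 0 for all 0 ≤ i ≤ N. -/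

import Mathlib

open MeasureTheory Filter

/-- `F(y) = ∫_0^y f(x) dx`. -/
noncomputable def Fint (f : ℝ → ℝ) (y : ℝ) : ℝ := ∫ x in (0:ℝ)..y, f x

/-- `F̃(x) = ∫_0^x y f(y) dy`. -/
noncomputable def Ftil (f : ℝ → ℝ) (x : ℝ) : ℝ := ∫ y in (0:ℝ)..x, y * f y

/-- `G = F̃ ∘ F⁻¹`, where `Finv` plays the role of `F⁻¹`. -/
noncomputable def Gfun (f Finv : ℝ → ℝ) (x : ℝ) : ℝ := Ftil f (Finv x)

/-- `a_i = exp(-∫_{t_{i-1}}^{t_i} ρ_u du)`. -/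
noncomputable def aC (ρ : ℝ → ℝ) (t : ℕ → ℝ) (i : ℕ) : ℝ :=
  Real.exp (-∫ s in (t (i - 1))..(t i), ρ s)

/-- `ã_i = a_i · λ(t_{i-1})/λ(t_i)`. -/
noncomputable def aT (ρ lam : ℝ → ℝ) (t : ℕ → ℝ) (i : ℕ) : ℝ :=
  aC ρ t i * lam (t (i - 1)) / lam (t i)

/-- Extension of a trade vector `ξ ∈ ℝ^{N+1}` to an `ℕ`-indexed family (zero beyond `N`). -/
def pad {N : ℕ} (ξ : Fin (N + 1) → ℝ) (n : ℕ) : ℝ := if h : n < N + 1 then ξ ⟨n, h⟩ else 0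

/-- The volume impact: `E_0 = 0`, `E_n = a_n (E_{n-1} + ξ_{n-1})`. -/
noncomputable def Evol (ρ : ℝ → ℝ) (t : ℕ → ℝ) (ξ : ℕ → ℝ) : ℕ → ℝ
  | 0 => 0
  | n + 1 => aC ρ t (n + 1) * (Evol ρ t ξ n + ξ n)

/-- The model-V cost `C^V(ξ, t) = Σ_{n=0}^N λ(t_n) [G((E_n + ξ_n)/λ(t_n)) − G(E_n/λ(t_n))]`. -/
noncomputable def CVg (f ρ lam Finv : ℝ → ℝ) (N : ℕ) (t : ℕ → ℝ)
    (ξ : Fin (N + 1) → ℝ) : ℝ :=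
  ∑ n ∈ Finset.range (N + 1),
    lam (t n) * (Gfun f Finv ((Evol ρ t (pad ξ) n + pad ξ n) / lam (t n)) -
      Gfun f Finv (Evol ρ t (pad ξ) n / lam (t n)))

/-- `h_{V,i}(x) = (F⁻¹(x) − a_i F⁻¹(ã_i x))/(1 − a_i)`. -/
noncomputable def hV (ρ lam Finv : ℝ → ℝ) (t : ℕ → ℝ) (i : ℕ) (x : ℝ) : ℝ :=
  (Finv x - aC ρ t i * Finv (aT ρ lam t i * x)) / (1 - aC ρ t i)

section Calculus

variable {φ φ' : ℝ → ℝ}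

lemma exists_hasDerivAt_eq_slope_of_ne (hφ : ∀ x, HasDerivAt φ (φ' x) x) {u v : ℝ} (huv : u ≠ v) :
    ∃ c, (u < c ∧ c < v ∨ v < c ∧ c < u) ∧ φ v - φ u = φ' c * (v - u) := by
  have hc : Continuous φ := continuous_iff_continuousAt.2 fun x => (hφ x).continuousAt
  rcases lt_or_gt_of_ne huv with h | h
  · obtain ⟨c, hcm, e⟩ :=
      exists_hasDerivAt_eq_slope φ φ' h hc.continuousOn fun x _ => hφ x
    refine ⟨c, Or.inl hcm, ?_⟩
    rw [e, div_mul_cancel₀ _ (sub_ne_zero.2 huv.symm)]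
  · obtain ⟨c, hcm, e⟩ :=
      exists_hasDerivAt_eq_slope φ φ' h hc.continuousOn fun x _ => hφ x
    refine ⟨c, Or.inr hcm, ?_⟩
    have := sub_ne_zero.2 huv
    rw [e]
    field_simp
    ring

lemma tangent_lt_of_strictMono (hφ : ∀ x, HasDerivAt φ (φ' x) x) (hm : StrictMono φ') {u v : ℝ}
    (huv : u ≠ v) : φ u + φ' u * (v - u) < φ v := by
  obtain ⟨c, h | h, e⟩ := exists_hasDerivAt_eq_slope_of_ne hφ huv
  · nlinarith [mul_pos (sub_pos.2 (hm h.1)) (sub_pos.2 (h.1.trans h.2))]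
  · nlinarith [mul_pos (sub_pos.2 (hm h.2)) (sub_pos.2 (h.1.trans h.2))]

lemma tangent_le_of_monotoneOn (hφ : ∀ x, HasDerivAt φ (φ' x) x)
    (hm : MonotoneOn φ' (Set.Ici 0)) {u v : ℝ} (hu : 0 ≤ u) (hv : 0 ≤ v) :
    φ u + φ' u * (v - u) ≤ φ v := by
  rcases eq_or_ne u v with rfl | huv
  · simp
  obtain ⟨c, h | h, e⟩ := exists_hasDerivAt_eq_slope_of_ne hφ huv
  · have := hm (Set.mem_Ici.2 hu) (Set.mem_Ici.2 (hu.trans h.1.le)) h.1.le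
    nlinarith [mul_nonneg (sub_nonneg.2 this) (sub_nonneg.2 (h.1.trans h.2).le)]
  · have := hm (Set.mem_Ici.2 (hv.trans h.1.le)) (Set.mem_Ici.2 hu) h.2.le
    nlinarith [mul_nonneg (sub_nonneg.2 this) (sub_nonneg.2 (h.1.trans h.2).le)]

lemma le_tangent_of_antitoneOn (hφ : ∀ x, HasDerivAt φ (φ' x) x)
    (hm : AntitoneOn φ' (Set.Iic 0)) {u v : ℝ} (hu : u ≤ 0) (hv : v ≤ 0) :
    φ v ≤ φ u + φ' u * (v - u) := by
  rcases eq_or_ne u v with rfl | huv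
  · simp
  obtain ⟨c, h | h, e⟩ := exists_hasDerivAt_eq_slope_of_ne hφ huv
  · have := hm (Set.mem_Iic.2 hu) (Set.mem_Iic.2 (h.2.le.trans hv)) h.1.le
    nlinarith [mul_nonneg (sub_nonneg.2 this) (sub_nonneg.2 (h.1.trans h.2).le)]
  · have := hm (Set.mem_Iic.2 (h.2.le.trans hu)) (Set.mem_Iic.2 hu) h.2.le
    nlinarith [mul_nonneg (sub_nonneg.2 this) (sub_nonneg.2 (h.1.trans h.2).le)]

end Calculus

/-- A cost `φ` with `φ 0 = 0` whose derivative is `w` times a strictly increasing bijection `ψ`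
fixing `0`. -/
structure IsCoerciveCost (φ ψ : ℝ → ℝ) (w : ℝ) : Prop where
  weight_pos : 0 < w
  zero : φ 0 = 0
  hasDerivAt : ∀ x, HasDerivAt φ (w * ψ x) x
  strictMono : StrictMono ψ
  surjective : Function.Surjective ψ
  marginal_zero : ψ 0 = 0

namespace IsCoerciveCost

variable {φ ψ : ℝ → ℝ} {w : ℝ}

lemma tangent_lt (h : IsCoerciveCost φ ψ w) {u v : ℝ} (huv : u ≠ v) :
    φ u + w * ψ u * (v - u) < φ v :=
  tangent_lt_of_strictMono h.hasDerivAt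
    (fun _ _ hxy => mul_lt_mul_of_pos_left (h.strictMono hxy) h.weight_pos) huv

lemma tangent_le (h : IsCoerciveCost φ ψ w) (u v : ℝ) : φ u + w * ψ u * (v - u) ≤ φ v := by
  rcases eq_or_ne u v with rfl | huv
  · simp
  · exact (h.tangent_lt huv).le

lemma nonneg (h : IsCoerciveCost φ ψ w) (y : ℝ) : 0 ≤ φ y := by
  simpa [h.zero, h.marginal_zero] using h.tangent_le 0 y

lemma exists_abs_le (h : IsCoerciveCost φ ψ w) : ∃ c, 0 ≤ c ∧ ∀ y, |y| ≤ c * φ y + 1 := by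
  have h1 : 0 < w * ψ 1 :=
    mul_pos h.weight_pos (by simpa [h.marginal_zero] using h.strictMono one_pos)
  have h2 : 0 < -(w * ψ (-1)) := by
    have : ψ (-1) < 0 := by
      simpa [h.marginal_zero] using h.strictMono (show (-1 : ℝ) < 0 by norm_num)
    nlinarith [mul_pos h.weight_pos (neg_pos.2 this)]
  refine ⟨1 / (w * ψ 1) + 1 / -(w * ψ (-1)), by positivity, fun y => ?_⟩
  have e1 : 0 ≤ 1 / (w * ψ 1) * φ y := mul_nonneg (by positivity) (h.nonneg y)
  have e2 : 0 ≤ 1 / -(w * ψ (-1)) * φ y := mul_nonneg (by positivity) (h.nonneg y)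
  rw [add_mul]
  have d1 : y - 1 ≤ 1 / (w * ψ 1) * φ y := by
    rw [one_div_mul_eq_div, le_div_iff₀ h1]
    linarith [h.tangent_le 1 y, h.nonneg 1]
  have d2 : -y - 1 ≤ 1 / -(w * ψ (-1)) * φ y := by
    rw [one_div_mul_eq_div, le_div_iff₀ h2]
    linarith [h.tangent_le (-1) y, h.nonneg (-1)]
  exact abs_le'.2 ⟨by linarith, by linarith⟩

lemma exists_inverse (h : IsCoerciveCost φ ψ w) :
    ∃ k : ℝ → ℝ, Continuous k ∧ StrictMono k ∧ Tendsto k atTop atTop ∧ Tendsto k atBot atBot ∧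
      ∀ y, ψ (k y) = y := by
  let e := h.strictMono.orderIsoOfSurjective ψ h.surjective
  exact ⟨e.symm, e.symm.continuous, e.symm.strictMono, e.symm.tendsto_atTop, e.symm.tendsto_atBot,
    fun y => e.apply_symm_apply y⟩

end IsCoerciveCost

section Separable

variable {N : ℕ} {φ ψ : ℕ → ℝ → ℝ} {w : ℕ → ℝ}

lemma exists_multiplier (h : ∀ n ≤ N, IsCoerciveCost (φ n) (ψ n) (w n)) (x : ℝ) :
    ∃ (ν : ℝ) (y : ℕ → ℝ), (∀ n ≤ N, ψ n (y n) = ν) ∧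
      ∑ n ∈ Finset.range (N + 1), w n * y n = x ∧
      (∀ n ≤ N, 0 ≤ ν → 0 ≤ y n) ∧ (∀ n ≤ N, ν ≤ 0 → y n ≤ 0) ∧
      (0 ≤ ν ∧ 0 ≤ x ∨ ν ≤ 0 ∧ x ≤ 0) := by
  choose k hkc hkm hkt hkb hk using fun n : {n // n ≤ N} => (h n n.2).exists_inverse
  have hk0 : ∀ n, k n 0 = 0 := fun n =>
    (h n n.2).strictMono.injective ((hk n 0).trans (h n n.2).marginal_zero.symm)
  let K : ℕ → ℝ → ℝ := fun n => if hn : n ≤ N then k ⟨n, hn⟩ else 0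
  have hK : ∀ n (hn : n ≤ N), K n = k ⟨n, hn⟩ := fun n hn => dif_pos hn
  have hmem : ∀ n ∈ Finset.range (N + 1), n ≤ N := fun n hn =>
    Nat.lt_succ_iff.1 (Finset.mem_range.1 hn)
  have hpos : ∀ n ≤ N, ∀ ν, 0 ≤ ν → 0 ≤ K n ν := fun n hn ν hν => by
    rw [hK n hn, ← hk0 ⟨n, hn⟩]
    exact (hkm _).monotone hν
  have hneg : ∀ n ≤ N, ∀ ν, ν ≤ 0 → K n ν ≤ 0 := fun n hn ν hν => by
    rw [hK n hn, ← hk0 ⟨n, hn⟩]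
    exact (hkm _).monotone hν
  let S : ℝ → ℝ := fun ν => ∑ n ∈ Finset.range (N + 1), w n * K n ν
  have hSc : Continuous S := continuous_finsetSum _ fun n hn => by
    rw [hK n (hmem n hn)]
    exact continuous_const.mul (hkc _)
  have hwN := (h N le_rfl).weight_pos
  have hSt : Tendsto S atTop atTop := by
    refine tendsto_atTop_mono' _ ?_ (((hkt ⟨N, le_rfl⟩)).const_mul_atTop hwN)
    filter_upwards [eventually_ge_atTop 0] with ν hν
    rw [← hK N le_rfl]
    exact Finset.single_le_sum (f := fun n => w n * K n ν)
      (fun n hn => mul_nonneg (h n (hmem n hn)).weight_pos.le (hpos n (hmem n hn) ν hν))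
      (Finset.self_mem_range_succ N)
  have hSb : Tendsto S atBot atBot := by
    refine tendsto_atBot_mono' _ ?_ (((hkb ⟨N, le_rfl⟩)).const_mul_atBot hwN)
    filter_upwards [eventually_le_atBot 0] with ν hν
    rw [← hK N le_rfl, ← neg_le_neg_iff, ← Finset.sum_neg_distrib]
    refine Finset.single_le_sum (f := fun n => -(w n * K n ν))
      (fun n hn => ?_) (Finset.self_mem_range_succ N)
    have := mul_nonneg (h n (hmem n hn)).weight_pos.le (neg_nonneg.2 (hneg n (hmem n hn) ν hν))
    simpa using this
  obtain ⟨ν, hν⟩ := hSc.surjective hSt hSb x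
  refine ⟨ν, fun n => K n ν, fun n hn => by simp only [hK n hn]; exact hk ⟨n, hn⟩ ν, hν,
    fun n hn => hpos n hn ν, fun n hn => hneg n hn ν, ?_⟩
  rcases le_total 0 ν with h0 | h0
  · refine Or.inl ⟨h0, hν ▸ Finset.sum_nonneg fun n hn => ?_⟩
    exact mul_nonneg (h n (hmem n hn)).weight_pos.le (hpos n (hmem n hn) ν h0)
  · refine Or.inr ⟨h0, hν ▸ Finset.sum_nonpos fun n hn => ?_⟩
    exact mul_nonpos_of_nonneg_of_nonpos (h n (hmem n hn)).weight_pos.le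
      (hneg n (hmem n hn) ν h0)

lemma multiplier_unique (h : ∀ n ≤ N, IsCoerciveCost (φ n) (ψ n) (w n)) {ν ν' : ℝ}
    {y y' : ℕ → ℝ} (hy : ∀ n ≤ N, ψ n (y n) = ν) (hy' : ∀ n ≤ N, ψ n (y' n) = ν')
    (hsum : ∑ n ∈ Finset.range (N + 1), w n * y n = ∑ n ∈ Finset.range (N + 1), w n * y' n) :
    ν = ν' := by
  have key : ∀ {ν ν' : ℝ} {y y' : ℕ → ℝ}, (∀ n ≤ N, ψ n (y n) = ν) →
      (∀ n ≤ N, ψ n (y' n) = ν') → ν < ν' →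
      ∑ n ∈ Finset.range (N + 1), w n * y n < ∑ n ∈ Finset.range (N + 1), w n * y' n := by
    intro ν ν' y y' hy hy' hlt
    refine Finset.sum_lt_sum_of_nonempty Finset.nonempty_range_add_one fun n hn => ?_
    have hn' : n ≤ N := Nat.lt_succ_iff.1 (Finset.mem_range.1 hn)
    refine mul_lt_mul_of_pos_left ((h n hn').strictMono.lt_iff_lt.1 ?_) (h n hn').weight_pos
    rwa [hy n hn', hy' n hn']
  rcases lt_trichotomy ν ν' with hlt | heq | hlt
  · exact absurd hsum (key hy hy' hlt).ne
  · exact heq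
  · exact absurd hsum (key hy' hy hlt).ne'

lemma sum_tangent {ν : ℝ} {y y' : ℕ → ℝ} (hy : ∀ n ≤ N, ψ n (y n) = ν)
    (hsum : ∑ n ∈ Finset.range (N + 1), w n * y n = ∑ n ∈ Finset.range (N + 1), w n * y' n) :
    ∑ n ∈ Finset.range (N + 1), (φ n (y n) + w n * ψ n (y n) * (y' n - y n)) =
      ∑ n ∈ Finset.range (N + 1), φ n (y n) := by
  have : ∑ n ∈ Finset.range (N + 1), w n * ψ n (y n) * (y' n - y n) =
      ν * (∑ n ∈ Finset.range (N + 1), w n * y' n - ∑ n ∈ Finset.range (N + 1), w n * y n) := by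
    rw [← Finset.sum_sub_distrib, Finset.mul_sum]
    refine Finset.sum_congr rfl fun n hn => ?_
    rw [hy n (Nat.lt_succ_iff.1 (Finset.mem_range.1 hn))]
    ring
  rw [Finset.sum_add_distrib, this, hsum]
  simp

lemma separable_le (h : ∀ n ≤ N, IsCoerciveCost (φ n) (ψ n) (w n)) {ν : ℝ} {y y' : ℕ → ℝ}
    (hy : ∀ n ≤ N, ψ n (y n) = ν)
    (hsum : ∑ n ∈ Finset.range (N + 1), w n * y n = ∑ n ∈ Finset.range (N + 1), w n * y' n) :
    ∑ n ∈ Finset.range (N + 1), φ n (y n) ≤ ∑ n ∈ Finset.range (N + 1), φ n (y' n) := by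
  rw [← sum_tangent hy hsum]
  exact Finset.sum_le_sum fun n hn =>
    (h n (Nat.lt_succ_iff.1 (Finset.mem_range.1 hn))).tangent_le _ _

lemma separable_lt (h : ∀ n ≤ N, IsCoerciveCost (φ n) (ψ n) (w n)) {ν : ℝ} {y y' : ℕ → ℝ}
    (hy : ∀ n ≤ N, ψ n (y n) = ν)
    (hsum : ∑ n ∈ Finset.range (N + 1), w n * y n = ∑ n ∈ Finset.range (N + 1), w n * y' n)
    (hne : ∃ n ≤ N, y n ≠ y' n) :
    ∑ n ∈ Finset.range (N + 1), φ n (y n) < ∑ n ∈ Finset.range (N + 1), φ n (y' n) := by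
  obtain ⟨m, hm, hne⟩ := hne
  rw [← sum_tangent hy hsum]
  exact Finset.sum_lt_sum
    (fun n hn => (h n (Nat.lt_succ_iff.1 (Finset.mem_range.1 hn))).tangent_le _ _)
    ⟨m, Finset.mem_range.2 (Nat.lt_succ_iff.2 hm), (h m hm).tangent_lt hne⟩

end Separable

/-- An increasing bijection `g` fixing `0` with positive derivative `d`, convex on the positive and
concave on the negative half-line. -/
structure IsImpactFn (g d : ℝ → ℝ) : Prop where
  hasDerivAt : ∀ x, HasDerivAt g (d x) x
  deriv_pos : ∀ x, 0 < d x
  monotoneOn : MonotoneOn d (Set.Ici 0)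
  antitoneOn : AntitoneOn d (Set.Iic 0)
  zero : g 0 = 0
  surjective : Function.Surjective g

/-- `x ↦ (g x − a g (b x)) / (1 − a)`. -/
noncomputable def resilientImpact (g : ℝ → ℝ) (a b x : ℝ) : ℝ := (g x - a * g (b * x)) / (1 - a)

namespace IsImpactFn

variable {g d : ℝ → ℝ} {a b a' b' z : ℝ}

lemma strictMono (h : IsImpactFn g d) : StrictMono g :=
  strictMono_of_hasDerivAt_pos h.hasDerivAt h.deriv_pos

lemma tendsto_atTop (h : IsImpactFn g d) : Tendsto g atTop atTop :=
  (h.strictMono.orderIsoOfSurjective g h.surjective).tendsto_atTop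

lemma tendsto_atBot (h : IsImpactFn g d) : Tendsto g atBot atBot :=
  (h.strictMono.orderIsoOfSurjective g h.surjective).tendsto_atBot

lemma hasDerivAt_resilientImpact (h : IsImpactFn g d) (x : ℝ) :
    HasDerivAt (resilientImpact g a b) ((d x - a * (d (b * x) * b)) / (1 - a)) x := by
  have h1 : HasDerivAt (fun y : ℝ => b * y) b x := by simpa using (hasDerivAt_id x).const_mul b
  exact ((h.hasDerivAt x).sub (((h.hasDerivAt (b * x)).comp x h1).const_mul a)).div_const _

lemma resilientImpact_strictMono (h : IsImpactFn g d) (ha : 0 < a) (ha1 : a < 1) (hb : 0 < b)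
    (hb1 : b ≤ 1) : StrictMono (resilientImpact g a b) := by
  refine strictMono_of_hasDerivAt_pos h.hasDerivAt_resilientImpact fun x => ?_
  refine div_pos ?_ (sub_pos.2 ha1)
  have hle : d (b * x) ≤ d x := by
    rcases le_total 0 x with hx | hx
    · exact h.monotoneOn (Set.mem_Ici.2 (mul_nonneg hb.le hx)) (Set.mem_Ici.2 hx)
        (mul_le_of_le_one_left hx hb1)
    · exact h.antitoneOn (Set.mem_Iic.2 hx)
        (Set.mem_Iic.2 (mul_nonpos_of_nonneg_of_nonpos hb.le hx)) (by nlinarith)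
  have h1 : d (b * x) * b ≤ d x := by nlinarith [h.deriv_pos x, h.deriv_pos (b * x)]
  nlinarith [h.deriv_pos x]

lemma le_resilientImpact (h : IsImpactFn g d) (ha : 0 < a) (ha1 : a < 1)
    (hb1 : b ≤ 1) (hz : 0 ≤ z) : g z ≤ resilientImpact g a b z := by
  rw [resilientImpact, le_div_iff₀ (sub_pos.2 ha1)]
  nlinarith [h.strictMono.monotone (mul_le_of_le_one_left hz hb1)]

lemma resilientImpact_le (h : IsImpactFn g d) (ha : 0 < a) (ha1 : a < 1)
    (hb1 : b ≤ 1) (hz : z ≤ 0) : resilientImpact g a b z ≤ g z := by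
  rw [resilientImpact, div_le_iff₀ (sub_pos.2 ha1)]
  nlinarith [h.strictMono.monotone (show z ≤ b * z by nlinarith)]

lemma resilientImpact_surjective (h : IsImpactFn g d) (ha : 0 < a) (ha1 : a < 1) (hb1 : b ≤ 1) :
    Function.Surjective (resilientImpact g a b) := by
  refine Continuous.surjective
    (continuous_iff_continuousAt.2 fun x => (h.hasDerivAt_resilientImpact x).continuousAt) ?_ ?_
  · refine tendsto_atTop_mono' _ ?_ h.tendsto_atTop
    filter_upwards [eventually_ge_atTop 0] with z hz using h.le_resilientImpact ha ha1 hb1 hz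
  · refine tendsto_atBot_mono' _ ?_ h.tendsto_atBot
    filter_upwards [eventually_le_atBot 0] with z hz using h.resilientImpact_le ha ha1 hb1 hz

lemma resilientImpact_zero (h : IsImpactFn g d) : resilientImpact g a b 0 = 0 := by
  simp [resilientImpact, h.zero]

lemma resilientImpact_eq_add (g : ℝ → ℝ) (ha1 : a < 1) (u : ℝ) :
    resilientImpact g a b u = g u + a * (g u - g (b * u)) / (1 - a) := by
  have := (sub_pos.2 ha1).ne'
  rw [resilientImpact]
  field_simp
  ring

lemma resilientImpact_eq_add' (g : ℝ → ℝ) (ha1 : a < 1) (u : ℝ) :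
    resilientImpact g a b u = g (b * u) + (g u - g (b * u)) / (1 - a) := by
  have := (sub_pos.2 ha1).ne'
  rw [resilientImpact]
  field_simp
  ring

lemma mul_decay_le (ha1' : a' < 1) (hb : 0 < b) (hb1' : b' ≤ 1)
    (hcond : (1 - b') / (1 - a') ≤ 1 / b * ((1 - b) / (1 - a))) :
    a' * ((1 - b') * b) / (1 - a') ≤ (1 - b) / (1 - a) := by
  have h0 : 0 ≤ (1 - b') / (1 - a') := div_nonneg (sub_nonneg.2 hb1') (sub_pos.2 ha1').le
  calc a' * ((1 - b') * b) / (1 - a') = a' * (b * ((1 - b') / (1 - a'))) := by ring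
    _ ≤ 1 * (b * ((1 - b') / (1 - a'))) := by gcongr
    _ ≤ b * (1 / b * ((1 - b) / (1 - a))) := by rw [one_mul]; gcongr
    _ = (1 - b) / (1 - a) := by field_simp

lemma resilientImpact_mul_le (h : IsImpactFn g d) (ha1 : a < 1) (hb : 0 < b)
    (ha' : 0 < a') (ha1' : a' < 1) (hb' : 0 < b') (hb1' : b' ≤ 1)
    (hcond : (1 - b') / (1 - a') ≤ 1 / b * ((1 - b) / (1 - a))) (hz : 0 ≤ z) :
    resilientImpact g a' b' (b * z) ≤ resilientImpact g a b z := by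
  rw [resilientImpact_eq_add g ha1', resilientImpact_eq_add' g ha1]
  have hu : 0 ≤ b * z := mul_nonneg hb.le hz
  have t1 := tangent_le_of_monotoneOn h.hasDerivAt h.monotoneOn hu (mul_nonneg hb'.le hu)
  have t2 := tangent_le_of_monotoneOn h.hasDerivAt h.monotoneOn hu hz
  have p := sub_pos.2 ha1
  have p' := sub_pos.2 ha1'
  refine add_le_add le_rfl ?_
  calc a' * (g (b * z) - g (b' * (b * z))) / (1 - a')
      ≤ a' * (d (b * z) * ((1 - b') * (b * z))) / (1 - a') := by gcongr; linarith
    _ = a' * ((1 - b') * b) / (1 - a') * (d (b * z) * z) := by ring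
    _ ≤ (1 - b) / (1 - a) * (d (b * z) * z) :=
        mul_le_mul_of_nonneg_right (mul_decay_le ha1' hb hb1' hcond)
          (mul_nonneg (h.deriv_pos _).le hz)
    _ = d (b * z) * (z - b * z) / (1 - a) := by ring
    _ ≤ (g z - g (b * z)) / (1 - a) := by gcongr; linarith

lemma le_resilientImpact_mul (h : IsImpactFn g d) (ha1 : a < 1) (hb : 0 < b)
    (ha' : 0 < a') (ha1' : a' < 1) (hb' : 0 < b') (hb1' : b' ≤ 1)
    (hcond : (1 - b') / (1 - a') ≤ 1 / b * ((1 - b) / (1 - a))) (hz : z ≤ 0) :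
    resilientImpact g a b z ≤ resilientImpact g a' b' (b * z) := by
  rw [resilientImpact_eq_add g ha1', resilientImpact_eq_add' g ha1]
  have hu : b * z ≤ 0 := mul_nonpos_of_nonneg_of_nonpos hb.le hz
  have t1 := le_tangent_of_antitoneOn h.hasDerivAt h.antitoneOn hu
    (mul_nonpos_of_nonneg_of_nonpos hb'.le hu)
  have t2 := le_tangent_of_antitoneOn h.hasDerivAt h.antitoneOn hu hz
  have p := sub_pos.2 ha1
  have p' := sub_pos.2 ha1'
  refine add_le_add le_rfl ?_
  calc (g z - g (b * z)) / (1 - a)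
      ≤ d (b * z) * (z - b * z) / (1 - a) := by gcongr; linarith
    _ = (1 - b) / (1 - a) * (d (b * z) * z) := by ring
    _ ≤ a' * ((1 - b') * b) / (1 - a') * (d (b * z) * z) :=
        mul_le_mul_of_nonpos_right (mul_decay_le ha1' hb hb1' hcond)
          (mul_nonpos_of_nonneg_of_nonpos (h.deriv_pos _).le hz)
    _ = a' * (d (b * z) * ((1 - b') * (b * z))) / (1 - a') := by ring
    _ ≤ a' * (g (b * z) - g (b' * (b * z))) / (1 - a') := by gcongr; linarith

lemma isCoerciveCost_last (h : IsImpactFn g d) {G : ℝ → ℝ} (hG : ∀ x, HasDerivAt G (g x) x)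
    (hG0 : G 0 = 0) {l : ℝ} (hl : 0 < l) : IsCoerciveCost (fun y => l * G y) g l where
  weight_pos := hl
  zero := by simp [hG0]
  hasDerivAt x := (hG x).const_mul l
  strictMono := h.strictMono
  surjective := h.surjective
  marginal_zero := h.zero

lemma isCoerciveCost_step (h : IsImpactFn g d) {G : ℝ → ℝ} (hG : ∀ x, HasDerivAt G (g x) x)
    (hG0 : G 0 = 0) {l l' : ℝ} (hl : 0 < l) (ha : 0 < a) (ha1 : a < 1) (hb : 0 < b) (hb1 : b ≤ 1)
    (hbl : l' * b = a * l) :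
    IsCoerciveCost (fun y => l * G y - l' * G (b * y)) (resilientImpact g a b) (l * (1 - a)) where
  weight_pos := mul_pos hl (sub_pos.2 ha1)
  zero := by simp [hG0]
  hasDerivAt x := by
    have h1 : HasDerivAt (fun y : ℝ => b * y) b x := by simpa using (hasDerivAt_id x).const_mul b
    refine (((hG x).const_mul l).sub (((hG (b * x)).comp x h1).const_mul l')).congr_deriv ?_
    have := (sub_pos.2 ha1).ne'
    rw [resilientImpact]
    field_simp
    linear_combination -(g (b * x)) * hbl
  strictMono := h.resilientImpact_strictMono ha ha1 hb hb1
  surjective := h.resilientImpact_surjective ha ha1 hb1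
  marginal_zero := h.resilientImpact_zero

end IsImpactFn

section Shape

variable {f Finv : ℝ → ℝ}

lemma hasDerivAt_Fint (hf : Continuous f) (x : ℝ) : HasDerivAt (Fint f) (f x) x :=
  intervalIntegral.integral_hasDerivAt_right (hf.intervalIntegrable _ _)
    hf.aestronglyMeasurable.stronglyMeasurableAtFilter hf.continuousAt

lemma hasDerivAt_Ftil (hf : Continuous f) (x : ℝ) : HasDerivAt (Ftil f) (x * f x) x :=
  have h : Continuous fun y => y * f y := continuous_id.mul hf
  intervalIntegral.integral_hasDerivAt_right (h.intervalIntegrable _ _)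
    h.aestronglyMeasurable.stronglyMeasurableAtFilter h.continuousAt

lemma isImpactFn_Finv (hf : Continuous f) (hfpos : ∀ x, 0 < f x)
    (hFinv1 : ∀ y, Fint f (Finv y) = y) (hFinv2 : ∀ y, Finv (Fint f y) = y)
    (hfmono : MonotoneOn f (Set.Iic 0)) (hfanti : AntitoneOn f (Set.Ici 0)) :
    IsImpactFn Finv fun y => (f (Finv y))⁻¹ := by
  have hF : StrictMono (Fint f) := strictMono_of_hasDerivAt_pos (hasDerivAt_Fint hf) hfpos
  have hmono : StrictMono Finv := fun x y hxy => by
    rwa [← hF.lt_iff_lt, hFinv1, hFinv1]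
  have hsurj : Function.Surjective Finv := fun y => ⟨_, hFinv2 y⟩
  have hcont : Continuous Finv := hmono.monotone.continuous_of_surjective hsurj
  have h0 : Finv 0 = 0 := by
    have := hFinv2 0
    rwa [show Fint f 0 = 0 by simp [Fint]] at this
  have hnonneg : ∀ y, 0 ≤ y → 0 ≤ Finv y := fun y hy => h0 ▸ hmono.monotone hy
  have hnonpos : ∀ y, y ≤ 0 → Finv y ≤ 0 := fun y hy => by
    simpa [h0] using hmono.monotone hy
  exact
    { hasDerivAt := fun x => HasDerivAt.of_local_left_inverse hcont.continuousAt
        (hasDerivAt_Fint hf _) (hfpos _).ne' (Eventually.of_forall hFinv1)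
      deriv_pos := fun x => inv_pos.2 (hfpos _)
      monotoneOn := fun x hx y hy hxy => inv_anti₀ (hfpos _)
        (hfanti (hnonneg x hx) (hnonneg y hy) (hmono.monotone hxy))
      antitoneOn := fun x hx y hy hxy => inv_anti₀ (hfpos _)
        (hfmono (hnonpos x hx) (hnonpos y hy) (hmono.monotone hxy))
      zero := h0
      surjective := hsurj }

lemma hasDerivAt_Gfun (hf : Continuous f) (hfpos : ∀ x, 0 < f x)
    (hg : IsImpactFn Finv fun y => (f (Finv y))⁻¹) (x : ℝ) :
    HasDerivAt (Gfun f Finv) (Finv x) x := by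
  refine ((hasDerivAt_Ftil hf (Finv x)).comp x (hg.hasDerivAt x)).congr_deriv ?_
  rw [mul_assoc, mul_inv_cancel₀ (hfpos _).ne', mul_one]

end Shape

section Decay

variable {ρ lam : ℝ → ℝ} {t : ℕ → ℝ} {i N : ℕ}

lemma aC_pos : 0 < aC ρ t i := Real.exp_pos _

lemma aC_lt_one (hρ : Continuous ρ) (hρpos : ∀ s, 0 ≤ s → 0 < ρ s) (h0 : 0 ≤ t (i - 1))
    (hlt : t (i - 1) < t i) : aC ρ t i < 1 := by
  rw [aC, Real.exp_lt_one_iff, neg_lt_zero]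
  exact intervalIntegral.intervalIntegral_pos_of_pos_on (hρ.intervalIntegrable _ _)
    (fun s hs => hρpos s (h0.trans hs.1.le)) hlt

lemma aT_pos (hlampos : ∀ s, 0 ≤ s → 0 < lam s) (h0 : 0 ≤ t (i - 1)) (hlt : t (i - 1) < t i) :
    0 < aT ρ lam t i :=
  div_pos (mul_pos aC_pos (hlampos _ h0)) (hlampos _ (h0.trans hlt.le))

lemma monotoneOn_lam_mul_exp (hρ : Continuous ρ) (hlam : Differentiable ℝ lam)
    (hlampos : ∀ s, 0 ≤ s → 0 < lam s) (hres : ∀ s, 0 ≤ s → 0 ≤ ρ s + deriv lam s / lam s) :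
    MonotoneOn (fun s => lam s * Real.exp (∫ u in (0 : ℝ)..s, ρ u)) (Set.Ici 0) := by
  have hd : ∀ s, HasDerivAt (fun s => lam s * Real.exp (∫ u in (0 : ℝ)..s, ρ u))
      (deriv lam s * Real.exp (∫ u in (0 : ℝ)..s, ρ u) +
        lam s * (Real.exp (∫ u in (0 : ℝ)..s, ρ u) * ρ s)) s := fun s =>
    (hlam s).hasDerivAt.mul (hasDerivAt_Fint hρ s).exp
  refine monotoneOn_of_deriv_nonneg (convex_Ici 0)
    (fun s _ => (hd s).continuousAt.continuousWithinAt)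
    (fun s _ => (hd s).differentiableAt.differentiableWithinAt) fun s hs => ?_
  rw [interior_Ici, Set.mem_Ioi] at hs
  have hl := hlampos s hs.le
  rw [(hd s).deriv]
  have : deriv lam s * Real.exp (∫ u in (0 : ℝ)..s, ρ u) +
      lam s * (Real.exp (∫ u in (0 : ℝ)..s, ρ u) * ρ s) =
      lam s * Real.exp (∫ u in (0 : ℝ)..s, ρ u) * (ρ s + deriv lam s / lam s) := by
    field_simp
    ring
  rw [this]
  exact mul_nonneg (by positivity) (hres s hs.le)

lemma aT_le_one (hρ : Continuous ρ) (hlam : Differentiable ℝ lam)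
    (hlampos : ∀ s, 0 ≤ s → 0 < lam s) (hres : ∀ s, 0 ≤ s → 0 ≤ ρ s + deriv lam s / lam s)
    (h0 : 0 ≤ t (i - 1)) (hlt : t (i - 1) < t i) : aT ρ lam t i ≤ 1 := by
  have hi := h0.trans hlt.le
  have hm := monotoneOn_lam_mul_exp hρ hlam hlampos hres (Set.mem_Ici.2 h0) (Set.mem_Ici.2 hi)
    hlt.le
  simp only at hm
  rw [aT, div_le_one (hlampos _ hi), aC, ← intervalIntegral.integral_interval_sub_left
    (hρ.intervalIntegrable 0 _) (hρ.intervalIntegrable 0 _), neg_sub, Real.exp_sub,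
    div_mul_eq_mul_div, div_le_iff₀ (Real.exp_pos _)]
  linarith

end Decay

section Cost

variable {f ρ lam Finv : ℝ → ℝ} {t : ℕ → ℝ} {ξ ξ' : ℕ → ℝ} {N : ℕ}

/-- The normalised volume impact `(E_n + ξ_n) / λ(t_n)` right after the `n`-th trade. -/
noncomputable def postImpact (ρ lam : ℝ → ℝ) (t : ℕ → ℝ) (ξ : ℕ → ℝ) (n : ℕ) : ℝ :=
  (Evol ρ t ξ n + ξ n) / lam (t n)

/-- The contribution to the cost of the impact right after the `n`-th trade. -/
noncomputable def stepCost (f ρ lam Finv : ℝ → ℝ) (N : ℕ) (t : ℕ → ℝ) (n : ℕ) (y : ℝ) : ℝ :=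
  if n < N then
    lam (t n) * Gfun f Finv y - lam (t (n + 1)) * Gfun f Finv (aT ρ lam t (n + 1) * y)
  else lam (t n) * Gfun f Finv y

/-- The coefficient of the impact right after the `n`-th trade in the total volume traded. -/
noncomputable def stepWeight (ρ lam : ℝ → ℝ) (N : ℕ) (t : ℕ → ℝ) (n : ℕ) : ℝ :=
  if n < N then lam (t n) * (1 - aC ρ t (n + 1)) else lam (t n)

/-- The derivative of `stepCost` divided by `stepWeight`. -/
noncomputable def stepMarginal (ρ lam Finv : ℝ → ℝ) (N : ℕ) (t : ℕ → ℝ) (n : ℕ) : ℝ → ℝ :=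
  if n < N then hV ρ lam Finv t (n + 1) else Finv

lemma Evol_add (hl : ∀ n ≤ N, 0 < lam (t n)) {n : ℕ} (hn : n ≤ N) :
    Evol ρ t ξ n + ξ n = lam (t n) * postImpact ρ lam t ξ n :=
  (mul_div_cancel₀ _ (hl n hn).ne').symm

lemma Evol_succ (hl : ∀ n ≤ N, 0 < lam (t n)) {n : ℕ} (hn : n < N) :
    Evol ρ t ξ (n + 1) = aC ρ t (n + 1) * (lam (t n) * postImpact ρ lam t ξ n) := by
  rw [Evol, Evol_add hl hn.le]

lemma Evol_succ_div (hl : ∀ n ≤ N, 0 < lam (t n)) {n : ℕ} (hn : n < N) :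
    Evol ρ t ξ (n + 1) / lam (t (n + 1)) = aT ρ lam t (n + 1) * postImpact ρ lam t ξ n := by
  rw [Evol_succ hl hn, aT, Nat.add_sub_cancel]
  ring

lemma sum_range_succ_sub_eq (u v : ℕ → ℝ) (hv : v 0 = 0) (N : ℕ) :
    ∑ n ∈ Finset.range (N + 1), (u n - v n) =
      ∑ n ∈ Finset.range (N + 1), if n < N then u n - v (n + 1) else u n := by
  rw [Finset.sum_sub_distrib, Finset.sum_range_succ' v, hv, Finset.sum_range_succ,
    Finset.sum_range_succ, if_neg (lt_irrefl N),
    Finset.sum_congr rfl fun n hn => if_pos (Finset.mem_range.1 hn), Finset.sum_sub_distrib]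
  ring

lemma sum_trades_eq (hl : ∀ n ≤ N, 0 < lam (t n)) :
    ∑ n ∈ Finset.range (N + 1), ξ n =
      ∑ n ∈ Finset.range (N + 1), stepWeight ρ lam N t n * postImpact ρ lam t ξ n := by
  have h := sum_range_succ_sub_eq (fun n => Evol ρ t ξ n + ξ n) (Evol ρ t ξ) rfl N
  simp only [add_sub_cancel_left] at h
  rw [h]
  refine Finset.sum_congr rfl fun n hn => ?_
  rw [stepWeight]
  split_ifs with hn'
  · rw [Evol_succ hl hn', Evol_add hl hn'.le]
    ring
  · exact Evol_add hl (Nat.lt_succ_iff.1 (Finset.mem_range.1 hn))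

lemma CVg_eq_sum (hl : ∀ n ≤ N, 0 < lam (t n)) (hG0 : Gfun f Finv 0 = 0)
    (ξ : Fin (N + 1) → ℝ) :
    CVg f ρ lam Finv N t ξ = ∑ n ∈ Finset.range (N + 1),
      stepCost f ρ lam Finv N t n (postImpact ρ lam t (pad ξ) n) := by
  have h := sum_range_succ_sub_eq
    (fun n => lam (t n) * Gfun f Finv (postImpact ρ lam t (pad ξ) n))
    (fun n => lam (t n) * Gfun f Finv (Evol ρ t (pad ξ) n / lam (t n)))
    (by simp [Evol, hG0]) N
  simp only [← mul_sub] at h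
  refine h.trans (Finset.sum_congr rfl fun n hn => ?_)
  rw [stepCost]
  split_ifs with hn'
  · simp only [Evol_succ_div hl hn']
  · rfl

lemma eq_of_postImpact_eq (hl : ∀ n ≤ N, 0 < lam (t n))
    (h : ∀ n ≤ N, postImpact ρ lam t ξ n = postImpact ρ lam t ξ' n) :
    ∀ n ≤ N, ξ n = ξ' n := by
  intro n hn
  have hE : Evol ρ t ξ n = Evol ρ t ξ' n := by
    cases n with
    | zero => rfl
    | succ m => rw [Evol_succ hl hn, Evol_succ hl hn, h m (by omega)]
  have h1 := Evol_add (ρ := ρ) (ξ := ξ) hl hn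
  rw [h n hn, ← Evol_add hl hn, hE] at h1
  exact add_left_cancel h1

lemma postImpact_eq {y : ℕ → ℝ} (hl : ∀ n ≤ N, 0 < lam (t n)) (h0 : ξ 0 = lam (t 0) * y 0)
    (h : ∀ n < N, ξ (n + 1) = lam (t (n + 1)) * y (n + 1) - lam (t n) * aC ρ t (n + 1) * y n) :
    ∀ n ≤ N, postImpact ρ lam t ξ n = y n := by
  intro n
  induction n with
  | zero =>
    intro hn
    rw [postImpact, Evol, zero_add, h0, mul_div_cancel_left₀ _ (hl 0 hn).ne']
  | succ m ih =>
    intro hn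
    rw [postImpact, Evol_succ hl hn, ih (by omega), h m hn, div_eq_iff (hl _ hn).ne']
    ring

lemma abs_trade_le (hl : ∀ n ≤ N, 0 < lam (t n)) (ha : ∀ n < N, aC ρ t (n + 1) ≤ 1) {n : ℕ}
    (hn : n ≤ N) :
    |ξ n| ≤ 2 * ∑ k ∈ Finset.range (N + 1), lam (t k) * |postImpact ρ lam t ξ k| := by
  have hterm : ∀ m ≤ N, lam (t m) * |postImpact ρ lam t ξ m| ≤
      ∑ k ∈ Finset.range (N + 1), lam (t k) * |postImpact ρ lam t ξ k| := fun m hm =>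
    Finset.single_le_sum (f := fun k => lam (t k) * |postImpact ρ lam t ξ k|)
      (fun k hk => mul_nonneg (hl k (Nat.lt_succ_iff.1 (Finset.mem_range.1 hk))).le (abs_nonneg _))
      (Finset.mem_range.2 (Nat.lt_succ_iff.2 hm))
  have hE : |Evol ρ t ξ n| ≤
      ∑ k ∈ Finset.range (N + 1), lam (t k) * |postImpact ρ lam t ξ k| := by
    cases n with
    | zero =>
      simpa [Evol] using (mul_nonneg (hl 0 hn).le (abs_nonneg _)).trans (hterm 0 hn)
    | succ m =>
      rw [Evol_succ hl hn, abs_mul, abs_mul, abs_of_pos aC_pos, abs_of_pos (hl m (by omega))]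
      exact (mul_le_of_le_one_left (mul_nonneg (hl m (by omega)).le (abs_nonneg _))
        (ha m hn)).trans (hterm m (by omega))
  have h1 : ξ n = lam (t n) * postImpact ρ lam t ξ n - Evol ρ t ξ n := by
    rw [← Evol_add hl hn, add_sub_cancel_left]
  rw [h1, two_mul]
  refine (abs_sub _ _).trans (add_le_add ?_ hE)
  rw [abs_mul, abs_of_pos (hl n hn)]
  exact hterm n hn

lemma tendsto_CVg (hl : ∀ n ≤ N, 0 < lam (t n)) (ha : ∀ n < N, aC ρ t (n + 1) ≤ 1)
    (hG0 : Gfun f Finv 0 = 0)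
    (h : ∀ n ≤ N, IsCoerciveCost (stepCost f ρ lam Finv N t n) (stepMarginal ρ lam Finv N t n)
      (stepWeight ρ lam N t n)) :
    Tendsto (CVg f ρ lam Finv N t) (cocompact (Fin (N + 1) → ℝ)) atTop := by
  choose c hc0 hc using fun n : {n // n ≤ N} => (h n n.2).exists_abs_le
  let d : ℕ → ℝ := fun n => if hn : n ≤ N then c ⟨n, hn⟩ else 0
  have hd : ∀ n (hn : n ≤ N), d n = c ⟨n, hn⟩ := fun n hn => dif_pos hn
  set M := ∑ k ∈ Finset.range (N + 1), lam (t k) * d k with hM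
  set K := ∑ k ∈ Finset.range (N + 1), lam (t k) with hK
  have hM0 : 0 ≤ M := Finset.sum_nonneg fun k hk => by
    have hk' := Nat.lt_succ_iff.1 (Finset.mem_range.1 hk)
    exact mul_nonneg (hl k hk').le (hd k hk' ▸ hc0 _)
  have hbound : ∀ ξ : Fin (N + 1) → ℝ, ‖ξ‖ ≤ 2 * ((M + 1) * CVg f ρ lam Finv N t ξ + K) := by
    intro ξ
    have hS : ∑ k ∈ Finset.range (N + 1), lam (t k) * |postImpact ρ lam t (pad ξ) k| ≤
        (M + 1) * CVg f ρ lam Finv N t ξ + K := by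
      have hnn : ∀ k ∈ Finset.range (N + 1),
          0 ≤ stepCost f ρ lam Finv N t k (postImpact ρ lam t (pad ξ) k) := fun k hk =>
        (h k (Nat.lt_succ_iff.1 (Finset.mem_range.1 hk))).nonneg _
      have hC : 0 ≤ CVg f ρ lam Finv N t ξ := by
        rw [CVg_eq_sum hl hG0]
        exact Finset.sum_nonneg hnn
      suffices hs : ∑ k ∈ Finset.range (N + 1), lam (t k) * |postImpact ρ lam t (pad ξ) k| ≤
          M * CVg f ρ lam Finv N t ξ + K by linarith
      rw [hM, hK, Finset.sum_mul, ← Finset.sum_add_distrib]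
      refine Finset.sum_le_sum fun k hk => ?_
      have hk' := Nat.lt_succ_iff.1 (Finset.mem_range.1 hk)
      have h1 := hc ⟨k, hk'⟩ (postImpact ρ lam t (pad ξ) k)
      have h2 : stepCost f ρ lam Finv N t k (postImpact ρ lam t (pad ξ) k) ≤
          CVg f ρ lam Finv N t ξ := by
        rw [CVg_eq_sum hl hG0]
        exact Finset.single_le_sum
          (f := fun k => stepCost f ρ lam Finv N t k (postImpact ρ lam t (pad ξ) k)) hnn hk
      have h3 := mul_le_mul_of_nonneg_left h2 (hc0 ⟨k, hk'⟩)
      rw [← hd k hk'] at h1 h3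
      calc lam (t k) * |postImpact ρ lam t (pad ξ) k|
          ≤ lam (t k) * (d k * CVg f ρ lam Finv N t ξ + 1) :=
            mul_le_mul_of_nonneg_left (h1.trans (by simpa using h3)) (hl k hk').le
        _ = lam (t k) * d k * CVg f ρ lam Finv N t ξ + lam (t k) := by ring
    refine (pi_norm_le_iff_of_nonempty _).2 fun i => ?_
    have h1 := abs_trade_le (ξ := pad ξ) hl ha (Nat.lt_succ_iff.1 i.2)
    rw [show pad ξ i = ξ i from dif_pos i.2] at h1
    rw [Real.norm_eq_abs]
    linarith
  rw [tendsto_atTop]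
  intro b
  filter_upwards [(tendsto_norm_cocompact_atTop (E := Fin (N + 1) → ℝ)).eventually_ge_atTop
    (2 * ((M + 1) * b + K))] with ξ hξ
  have := hξ.trans (hbound ξ)
  exact le_of_mul_le_mul_left (by linarith) (show 0 < M + 1 by linarith)

lemma sum_stepWeight_eq (y z : ℕ → ℝ) (hyz : ∀ n < N, y n = z (n + 1)) :
    ∑ n ∈ Finset.range (N + 1), stepWeight ρ lam N t n * y n =
      ∑ i ∈ Finset.Icc 1 N, lam (t (i - 1)) * (1 - aC ρ t i) * z i + lam (t N) * y N := by
  rw [Finset.sum_range_succ, stepWeight, if_neg (lt_irrefl N), Finset.range_eq_Ico,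
    ← Finset.Ico_add_one_right_eq_Icc,
    ← Finset.sum_Ico_add' (fun i => lam (t (i - 1)) * (1 - aC ρ t i) * z i) 0 N 1]
  congr 1
  refine Finset.sum_congr rfl fun n hn => ?_
  have hn' := (Finset.mem_Ico.1 hn).2
  rw [stepWeight, if_pos hn', hyz n hn', Nat.add_sub_cancel]

end Cost

theorem stmt14 (f ρ lam Finv : ℝ → ℝ)
    (hf : Continuous f) (hfpos : ∀ x, 0 < f x)
    (hFbot : Tendsto (Fint f) atBot atBot) (hFtop : Tendsto (Fint f) atTop atTop)
    (hFinv1 : ∀ y, Fint f (Finv y) = y) (hFinv2 : ∀ y, Finv (Fint f y) = y)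
    (hfmono : MonotoneOn f (Set.Iic 0)) (hfanti : AntitoneOn f (Set.Ici 0))
    (hρ : ContDiff ℝ 1 ρ) (hρpos : ∀ s, 0 ≤ s → 0 < ρ s)
    (hlam : ContDiff ℝ 2 lam) (hlampos : ∀ s, 0 ≤ s → 0 < lam s)
    (hres : ∀ s, 0 ≤ s → 0 ≤ ρ s + deriv lam s / lam s)
    (N : ℕ) (hN : 1 ≤ N) (t : ℕ → ℝ) (ht0 : t 0 = 0)
    (htmono : ∀ i, i < N → t i < t (i + 1)) :
    (∀ ξ : Fin (N + 1) → ℝ, 0 ≤ CVg f ρ lam Finv N t ξ) ∧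
    Tendsto (CVg f ρ lam Finv N t) (cocompact (Fin (N + 1) → ℝ)) atTop ∧
    ∀ x : ℝ, ∃ ν : ℝ, ∃ z : ℕ → ℝ,
      (∀ i, 1 ≤ i → i ≤ N → hV ρ lam Finv t i (z i) = ν) ∧
      ((∑ i ∈ Finset.Icc 1 N, lam (t (i - 1)) * (1 - aC ρ t i) * z i) +
          lam (t N) * Fint f ν = -x) ∧
      (∀ ν' : ℝ, ∀ z' : ℕ → ℝ, (∀ i, 1 ≤ i → i ≤ N → hV ρ lam Finv t i (z' i) = ν') →
        (∑ i ∈ Finset.Icc 1 N, lam (t (i - 1)) * (1 - aC ρ t i) * z' i) +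
          lam (t N) * Fint f ν' = -x → ν' = ν) ∧
      ∀ ξstar : Fin (N + 1) → ℝ,
        (∀ i : Fin (N + 1), ξstar i =
          if i.val = 0 then lam (t 0) * z 1
          else if i.val = N then lam (t N) * Fint f ν - lam (t (N - 1)) * aC ρ t N * z N
          else lam (t i.val) * (z (i.val + 1) - aT ρ lam t i.val * z i.val)) →
        (∑ i, ξstar i = -x) ∧
        (∀ ξ : Fin (N + 1) → ℝ, ∑ i, ξ i = -x →
          CVg f ρ lam Finv N t ξstar ≤ CVg f ρ lam Finv N t ξ) ∧
        (∀ ξ : Fin (N + 1) → ℝ, ∑ i, ξ i = -x → ξ ≠ ξstar →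
          CVg f ρ lam Finv N t ξstar < CVg f ρ lam Finv N t ξ) ∧
        0 ≤ -x * ξstar 0 ∧ 0 ≤ -x * ξstar (Fin.last N) ∧
        ((∀ i, 1 ≤ i → i + 1 ≤ N →
            (1 - aT ρ lam t (i + 1)) / (1 - aC ρ t (i + 1)) ≤
              (1 / aT ρ lam t i) * ((1 - aT ρ lam t i) / (1 - aC ρ t i))) →
          ∀ i, 0 ≤ -x * ξstar i) := by
  have hg := isImpactFn_Finv hf hfpos hFinv1 hFinv2 hfmono hfanti
  have hG := hasDerivAt_Gfun hf hfpos hg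
  have hG0 : Gfun f Finv 0 = 0 := by simp [Gfun, hg.zero, Ftil]
  have ht : ∀ n ≤ N, 0 ≤ t n := fun n => by
    induction n with
    | zero => exact fun _ => ht0.ge
    | succ m ih => exact fun hm => (ih (by omega)).trans (htmono m hm).le
  have hl : ∀ n ≤ N, 0 < lam (t n) := fun n hn => hlampos _ (ht n hn)
  have ha1 : ∀ n < N, aC ρ t (n + 1) < 1 := fun n hn =>
    aC_lt_one hρ.continuous hρpos (ht n hn.le) (htmono n hn)
  have hb : ∀ n < N, 0 < aT ρ lam t (n + 1) := fun n hn =>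
    aT_pos hlampos (ht n hn.le) (htmono n hn)
  have hb1 : ∀ n < N, aT ρ lam t (n + 1) ≤ 1 := fun n hn =>
    aT_le_one hρ.continuous (hlam.differentiable (by norm_num)) hlampos hres (ht n hn.le)
      (htmono n hn)
  have hbl : ∀ n < N, lam (t (n + 1)) * aT ρ lam t (n + 1) = aC ρ t (n + 1) * lam (t n) :=
    fun n hn => mul_div_cancel₀ _ (hl (n + 1) hn).ne'
  have hcost : ∀ n ≤ N, IsCoerciveCost (stepCost f ρ lam Finv N t n)
      (stepMarginal ρ lam Finv N t n) (stepWeight ρ lam N t n) := by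
    intro n hn
    rcases hn.lt_or_eq with h | rfl
    · convert hg.isCoerciveCost_step hG hG0 (hl n hn) aC_pos (ha1 n h) (hb n h) (hb1 n h)
        (hbl n h) using 1
      · exact funext fun y => if_pos h
      · exact if_pos h
      · exact if_pos h
    · convert hg.isCoerciveCost_last hG hG0 (hl n hn) using 1
      · exact funext fun y => if_neg (lt_irrefl n)
      · exact if_neg (lt_irrefl n)
      · exact if_neg (lt_irrefl n)
  refine ⟨fun ξ => ?_, tendsto_CVg hl (fun n hn => (ha1 n hn).le) hG0 hcost, fun x => ?_⟩
  · rw [CVg_eq_sum hl hG0]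
    exact Finset.sum_nonneg fun n hn =>
      (hcost n (Nat.lt_succ_iff.1 (Finset.mem_range.1 hn))).nonneg _
  obtain ⟨ν, y, hy, hsum, hypos, hyneg, hsign⟩ := exists_multiplier hcost (-x)
  have hyV : ∀ n < N, hV ρ lam Finv t (n + 1) (y n) = ν := fun n hn => by
    have := hy n hn.le
    rwa [stepMarginal, if_pos hn] at this
  have hyN : y N = Fint f ν := by
    have := hy N le_rfl
    rw [stepMarginal, if_neg (lt_irrefl N)] at this
    rw [← this, hFinv1]
  have hsum' := sum_stepWeight_eq (ρ := ρ) (lam := lam) (t := t) y (fun i => y (i - 1))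
    (N := N) fun n _ => rfl
  refine ⟨ν, fun i => y (i - 1), fun i hi hiN => ?_, ?_, fun ν' z' hz' hs' => ?_,
    fun ξstar hξ => ?_⟩
  · obtain ⟨n, rfl⟩ : ∃ n, i = n + 1 := ⟨i - 1, by omega⟩
    exact hyV n hiN
  · rw [← hyN, ← hsum', hsum]
  · let y' : ℕ → ℝ := fun n => if n < N then z' (n + 1) else Fint f ν'
    have e := sum_stepWeight_eq (ρ := ρ) (lam := lam) (t := t) (N := N) y' z'
      fun n hn => if_pos hn
    have hyN' : y' N = Fint f ν' := if_neg (lt_irrefl N)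
    refine multiplier_unique hcost (y := y') (fun n hn => ?_) hy ?_
    · rcases hn.lt_or_eq with h | rfl
      · rw [stepMarginal, if_pos h, show y' n = z' (n + 1) from if_pos h]
        exact hz' (n + 1) (by omega) h
      · rw [stepMarginal, if_neg (lt_irrefl n), hyN', hFinv2]
    · rw [e, hyN', hs', hsum]
  have hpad : ∀ (ξ : Fin (N + 1) → ℝ) (i : Fin (N + 1)), pad ξ i = ξ i := fun ξ i => dif_pos i.2
  have hξ0 : ξstar 0 = lam (t 0) * y 0 := (hξ 0).trans (if_pos rfl)
  have hξs : ∀ n (hn : n < N), ξstar ⟨n + 1, by omega⟩ =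
      lam (t (n + 1)) * y (n + 1) - lam (t n) * aC ρ t (n + 1) * y n := by
    intro n hn
    rw [hξ, if_neg (Nat.succ_ne_zero n)]
    simp only [Nat.add_sub_cancel]
    split_ifs with h
    · subst h
      simp only [Nat.add_sub_cancel, hyN]
    · linear_combination -y n * hbl n hn
  have hpost : ∀ n ≤ N, postImpact ρ lam t (pad ξstar) n = y n :=
    postImpact_eq hl ((hpad ξstar 0).trans hξ0) fun n hn =>
      (hpad ξstar ⟨n + 1, by omega⟩).trans (hξs n hn)
  have htrades : ∀ ξ : Fin (N + 1) → ℝ, ∑ i, ξ i =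
      ∑ n ∈ Finset.range (N + 1), stepWeight ρ lam N t n * postImpact ρ lam t (pad ξ) n := by
    intro ξ
    rw [← sum_trades_eq hl, Finset.sum_range]
    exact Finset.sum_congr rfl fun i _ => (hpad ξ i).symm
  have hstar : CVg f ρ lam Finv N t ξstar =
      ∑ n ∈ Finset.range (N + 1), stepCost f ρ lam Finv N t n (y n) := by
    rw [CVg_eq_sum hl hG0]
    exact Finset.sum_congr rfl fun n hn => by
      rw [hpost n (Nat.lt_succ_iff.1 (Finset.mem_range.1 hn))]
  have hprod : ∀ u : ℝ, (0 ≤ ν → 0 ≤ u) → (ν ≤ 0 → u ≤ 0) → 0 ≤ -x * u := by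
    intro u h1 h2
    rcases hsign with ⟨h, h'⟩ | ⟨h, h'⟩
    · exact mul_nonneg h' (h1 h)
    · exact mul_nonneg_of_nonpos_of_nonpos h' (h2 h)
  have hfirst : 0 ≤ -x * ξstar 0 := by
    rw [hξ0]
    have := hl 0 (Nat.zero_le N)
    exact hprod _ (fun h => mul_nonneg this.le (hypos 0 (Nat.zero_le N) h))
      fun h => mul_nonpos_of_nonneg_of_nonpos this.le (hyneg 0 (Nat.zero_le N) h)
  have hξs' : ∀ n (hn : n < N), ξstar ⟨n + 1, by omega⟩ =
      lam (t (n + 1)) * (y (n + 1) - aT ρ lam t (n + 1) * y n) := fun n hn => by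
    rw [hξs n hn]
    linear_combination y n * hbl n hn
  have hstep : ∀ n (hn : n < N), (0 ≤ ν → aT ρ lam t (n + 1) * y n ≤ y (n + 1)) →
      (ν ≤ 0 → y (n + 1) ≤ aT ρ lam t (n + 1) * y n) →
      0 ≤ -x * ξstar ⟨n + 1, by omega⟩ := by
    intro n hn h1 h2
    rw [hξs' n hn]
    exact hprod _ (fun h => mul_nonneg (hl (n + 1) hn).le (sub_nonneg.2 (h1 h)))
      fun h => mul_nonpos_of_nonneg_of_nonpos (hl (n + 1) hn).le (sub_nonpos.2 (h2 h))
  have hlast : 0 ≤ -x * ξstar (Fin.last N) := by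
    obtain ⟨m, rfl⟩ : ∃ m, N = m + 1 := ⟨N - 1, by omega⟩
    have hm := m.lt_succ_self
    have hFN : Finv (y (m + 1)) = ν := by rw [hyN, hFinv2]
    refine hstep m hm (fun h => ?_) fun h => ?_
    · have h0 := hypos m hm.le h
      rw [← hg.strictMono.le_iff_le, hFN, ← hyV m hm]
      exact (hg.strictMono.monotone (mul_le_of_le_one_left h0 (hb1 m hm))).trans
        (hg.le_resilientImpact aC_pos (ha1 m hm) (hb1 m hm) h0)
    · have h0 := hyneg m hm.le h
      rw [← hg.strictMono.le_iff_le, hFN, ← hyV m hm]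
      exact (hg.resilientImpact_le aC_pos (ha1 m hm) (hb1 m hm) h0).trans
        (hg.strictMono.monotone (by nlinarith [hb1 m hm]))
  refine ⟨?_, fun ξ hs => ?_, fun ξ hs hne => ?_, hfirst, hlast, fun hcond i => ?_⟩
  · rw [htrades, ← hsum]
    exact Finset.sum_congr rfl fun n hn => by
      rw [hpost n (Nat.lt_succ_iff.1 (Finset.mem_range.1 hn))]
  · rw [hstar, CVg_eq_sum hl hG0]
    exact separable_le hcost hy (by rw [hsum, ← hs, htrades])
  · rw [hstar, CVg_eq_sum hl hG0]
    refine separable_lt hcost hy (by rw [hsum, ← hs, htrades]) ?_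
    by_contra! hcon
    refine hne (funext fun i => ?_)
    rw [← hpad ξ, ← hpad ξstar]
    exact eq_of_postImpact_eq hl (fun n hn => ((hpost n hn).trans (hcon n hn)).symm) i
      (Nat.lt_succ_iff.1 i.2)
  · obtain ⟨i, hi⟩ := i
    obtain _ | n := i
    · exact hfirst
    have hn : n < N := by omega
    rcases (Nat.succ_le_of_lt hn).lt_or_eq with h | rfl
    · have hmono := hg.resilientImpact_strictMono aC_pos (ha1 _ h) (hb _ h) (hb1 _ h)
      have e : resilientImpact Finv (aC ρ t (n + 1 + 1)) (aT ρ lam t (n + 1 + 1)) (y (n + 1)) =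
          resilientImpact Finv (aC ρ t (n + 1)) (aT ρ lam t (n + 1)) (y n) :=
        (hyV (n + 1) h).trans (hyV n hn).symm
      have hc := hcond (n + 1) (by omega) h
      refine hstep n hn (fun h0 => ?_) fun h0 => ?_
      · rw [← hmono.le_iff_le, e]
        exact hg.resilientImpact_mul_le (ha1 n hn) (hb n hn) aC_pos (ha1 _ h) (hb _ h) (hb1 _ h)
          hc (hypos n hn.le h0)
      · rw [← hmono.le_iff_le, e]
        exact hg.le_resilientImpact_mul (ha1 n hn) (hb n hn) aC_pos (ha1 _ h) (hb _ h) (hb1 _ h)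
          hc (hyneg n hn.le h0)
    · exact hlast
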